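/- Suppose (H, p, D, U) is an oriented quantum algebra. Write p = pᵢ ⊗ pⁱ = pⱼ ⊗ pʲ = p_k ⊗ p^k (three copies) and p⁻¹ = P_l ⊗ P^l. Then (H ⊗ H, α̃, D ⊗ D, U ⊗ U) is an oriented quantum algebra, where α̃ = (pᵢ pⱼ ⊗ p_k P^l) ⊗ (pʲ P_l ⊗ pⁱ p^k) ∈ (H ⊗ H) ⊗ (H ⊗ H). -/

import Mathlib

open TensorProduct

noncomputable section

namespace OQApaper

variable (K : Type*) [Field K]

section Maps

variable (A B C D : Type*) [Ring A] [Ring B] [Ring C] [Ring D]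
  [Algebra K A] [Algebra K B] [Algebra K C] [Algebra K D]

/-- The linear embedding `A ⊗ B → A ⊗ Bᵐᵒᵖ` (identity on the first factor, `op` on the
second), used to phrase statements about products in `H ⊗ H'^op`. -/
def opify : A ⊗[K] B →ₗ[K] A ⊗[K] Bᵐᵒᵖ :=
  TensorProduct.map LinearMap.id (MulOpposite.opLinearEquiv K).toLinearMap

/-- `a ⊗ b ↦ a ⊗ b ⊗ 1` into `A ⊗ (B ⊗ C)`. -/
def emb12 : A ⊗[K] B →ₐ[K] A ⊗[K] (B ⊗[K] C) :=
  Algebra.TensorProduct.map (AlgHom.id K A) Algebra.TensorProduct.includeLeft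

/-- `a ⊗ c ↦ a ⊗ 1 ⊗ c` into `A ⊗ (B ⊗ C)`. -/
def emb13 : A ⊗[K] C →ₐ[K] A ⊗[K] (B ⊗[K] C) :=
  Algebra.TensorProduct.map (AlgHom.id K A) Algebra.TensorProduct.includeRight

/-- `b ⊗ c ↦ 1 ⊗ b ⊗ c` into `A ⊗ (B ⊗ C)`. -/
def emb23 : B ⊗[K] C →ₐ[K] A ⊗[K] (B ⊗[K] C) :=
  Algebra.TensorProduct.includeRight

/-- `b ⊗ a ↦ a ⊗ b ⊗ 1` into `A ⊗ (B ⊗ C)` (swapped version of `emb12`). -/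
def emb21 : B ⊗[K] A →ₐ[K] A ⊗[K] (B ⊗[K] C) :=
  (emb12 K A B C).comp (Algebra.TensorProduct.comm K B A).toAlgHom

/-- `c ⊗ b ↦ 1 ⊗ b ⊗ c` into `A ⊗ (B ⊗ C)` (swapped version of `emb23`). -/
def emb32 : C ⊗[K] B →ₐ[K] A ⊗[K] (B ⊗[K] C) :=
  (emb23 K A B C).comp (Algebra.TensorProduct.comm K C B).toAlgHom

/-- `a ⊗ c ↦ (a ⊗ 1) ⊗ (c ⊗ 1)` into `(A ⊗ B) ⊗ (C ⊗ D)`. -/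
def E13 : A ⊗[K] C →ₐ[K] (A ⊗[K] B) ⊗[K] (C ⊗[K] D) :=
  Algebra.TensorProduct.map Algebra.TensorProduct.includeLeft
    Algebra.TensorProduct.includeLeft

/-- `a ⊗ d ↦ (a ⊗ 1) ⊗ (1 ⊗ d)` into `(A ⊗ B) ⊗ (C ⊗ D)`. -/
def E14 : A ⊗[K] D →ₐ[K] (A ⊗[K] B) ⊗[K] (C ⊗[K] D) :=
  Algebra.TensorProduct.map Algebra.TensorProduct.includeLeft
    Algebra.TensorProduct.includeRight

/-- `b ⊗ d ↦ (1 ⊗ b) ⊗ (1 ⊗ d)` into `(A ⊗ B) ⊗ (C ⊗ D)`. -/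
def E24 : B ⊗[K] D →ₐ[K] (A ⊗[K] B) ⊗[K] (C ⊗[K] D) :=
  Algebra.TensorProduct.map Algebra.TensorProduct.includeRight
    Algebra.TensorProduct.includeRight

/-- `b ⊗ c ↦ (1 ⊗ b) ⊗ (c ⊗ 1)` into `(A ⊗ B) ⊗ (C ⊗ D)`. -/
def E23 : B ⊗[K] C →ₐ[K] (A ⊗[K] B) ⊗[K] (C ⊗[K] D) :=
  Algebra.TensorProduct.map Algebra.TensorProduct.includeRight
    Algebra.TensorProduct.includeLeft

/-- `c ⊗ b ↦ (1 ⊗ b) ⊗ (c ⊗ 1)` into `(A ⊗ B) ⊗ (C ⊗ D)` (swapped `E23`). -/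
def E32 : C ⊗[K] B →ₐ[K] (A ⊗[K] B) ⊗[K] (C ⊗[K] D) :=
  (E23 K A B C D).comp (Algebra.TensorProduct.comm K C B).toAlgHom

end Maps

section Defs

variable {A B : Type*} [Ring A] [Ring B] [Algebra K A] [Algebra K B]

/-- An oriented quantum algebra `(A, r, σ, τ)` (Definition 1.1), with the inverse `ri`
of `r` given explicitly:  `σ, τ` are commuting algebra automorphisms, `(σ ⊗ id)(r⁻¹)`
and `(id ⊗ τ)(r)` are inverses in `A ⊗ Aᵐᵒᵖ`, `(σ ⊗ σ)(r) = r = (τ ⊗ τ)(r)`, and `r`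
satisfies the quantum Yang–Baxter equation. -/
structure IsOQA (r ri : A ⊗[K] A) (σ τ : A ≃ₐ[K] A) : Prop where
  comm_auto : ∀ a : A, σ (τ a) = τ (σ a)
  mul_inv : r * ri = 1
  inv_mul : ri * r = 1
  op_mul_inv :
    opify K A A (Algebra.TensorProduct.map σ.toAlgHom (AlgHom.id K A) ri) *
      opify K A A (Algebra.TensorProduct.map (AlgHom.id K A) τ.toAlgHom r) = 1
  op_inv_mul :
    opify K A A (Algebra.TensorProduct.map (AlgHom.id K A) τ.toAlgHom r) *
      opify K A A (Algebra.TensorProduct.map σ.toAlgHom (AlgHom.id K A) ri) = 1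
  map_sigma : Algebra.TensorProduct.map σ.toAlgHom σ.toAlgHom r = r
  map_tau : Algebra.TensorProduct.map τ.toAlgHom τ.toAlgHom r = r
  qybe : emb12 K A A A r * emb13 K A A A r * emb23 K A A A r =
    emb23 K A A A r * emb13 K A A A r * emb12 K A A A r

/-- An OQA nonuple `(A, B, p, p', r, σ, τ, σ', τ')` (Definition 3.1), with explicit
inverses `pinv, p'inv, rinv`. -/
structure IsOQANonuple (p pinv : A ⊗[K] A) (p' p'inv : B ⊗[K] B) (r rinv : A ⊗[K] B)
    (σ τ : A ≃ₐ[K] A) (σ' τ' : B ≃ₐ[K] B) : Prop where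
  comm_auto : ∀ a : A, σ (τ a) = τ (σ a)
  comm_auto' : ∀ b : B, σ' (τ' b) = τ' (σ' b)
  p_mul_inv : p * pinv = 1
  p_inv_mul : pinv * p = 1
  p'_mul_inv : p' * p'inv = 1
  p'_inv_mul : p'inv * p' = 1
  r_mul_inv : r * rinv = 1
  r_inv_mul : rinv * r = 1
  op_mul_inv :
    opify K A B (Algebra.TensorProduct.map σ.toAlgHom (AlgHom.id K B) rinv) *
      opify K A B (Algebra.TensorProduct.map (AlgHom.id K A) τ'.toAlgHom r) = 1
  op_inv_mul :
    opify K A B (Algebra.TensorProduct.map (AlgHom.id K A) τ'.toAlgHom r) *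
      opify K A B (Algebra.TensorProduct.map σ.toAlgHom (AlgHom.id K B) rinv) = 1
  map_sigma : Algebra.TensorProduct.map σ.toAlgHom σ'.toAlgHom r = r
  map_tau : Algebra.TensorProduct.map τ.toAlgHom τ'.toAlgHom r = r
  cond3 : emb12 K A A B p * emb13 K A A B r * emb23 K A A B r =
    emb23 K A A B r * emb13 K A A B r * emb12 K A A B p
  cond4 : emb12 K A B B r * emb13 K A B B r * emb23 K A B B p' =
    emb23 K A B B p' * emb13 K A B B r * emb12 K A B B r

end Defs

section BialgDefs

variable {A B : Type*} [Ring A] [Ring B] [Bialgebra K A] [Bialgebra K B]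

/-- A weak R-matrix of `(A, B)` (Definition 2.6):  an invertible `r ∈ A ⊗ B` with
`(Δ ⊗ id)(r) = r₁₃ r₂₃` and `(id ⊗ Δ)(r) = r₁₃ r₁₂`. -/
structure IsWeakR (r : A ⊗[K] B) : Prop where
  isUnit : IsUnit r
  comul_left :
    TensorProduct.assoc K A A B
        (TensorProduct.map (Coalgebra.comul (R := K)) LinearMap.id r) =
      emb13 K A A B r * emb23 K A A B r
  comul_right :
    TensorProduct.map LinearMap.id (Coalgebra.comul (R := K)) r =
      emb13 K A B B r * emb12 K A B B r

/-- A quasitriangular structure `p` on a bialgebra `A` (Definition 2.4). -/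
structure IsQT (p : A ⊗[K] A) : Prop where
  comul_left :
    TensorProduct.assoc K A A A
        (TensorProduct.map (Coalgebra.comul (R := K)) LinearMap.id p) =
      emb13 K A A A p * emb23 K A A A p
  comul_right :
    TensorProduct.map LinearMap.id (Coalgebra.comul (R := K)) p =
      emb13 K A A A p * emb12 K A A A p
  almost_cocomm : ∀ h : A,
    TensorProduct.comm K A A (Coalgebra.comul (R := K) h) * p =
      p * Coalgebra.comul (R := K) h
  counit_left :
    TensorProduct.lid K A
      (TensorProduct.map (Coalgebra.counit (R := K)) LinearMap.id p) = 1
  counit_right :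
    TensorProduct.rid K A
      (TensorProduct.map LinearMap.id (Coalgebra.counit (R := K)) p) = 1

end BialgDefs

end OQApaper

open OQApaper

namespace OQApaper

section Fusion

variable {G : Type*} [Monoid G]

/-- Fusion of the Yang–Baxter equation along the first strand. -/
lemma yangBaxter_fuse_first {a a' b b' c : G} (h : a * b * c = c * b * a)
    (h' : a' * b' * c = c * b' * a') (h₁ : Commute a' b) (h₂ : Commute a b') :
    (a * a') * (b * b') * c = c * (b * b') * (a * a') := by
  calc (a * a') * (b * b') * c = a * (a' * b) * (b' * c) := by simp only [mul_assoc]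
    _ = a * b * (a' * b' * c) := by rw [h₁.eq]; simp only [mul_assoc]
    _ = (a * b * c) * b' * a' := by rw [h']; simp only [mul_assoc]
    _ = c * b * (a * b') * a' := by rw [h]; simp only [mul_assoc]
    _ = c * (b * b') * (a * a') := by rw [h₂.eq]; simp only [mul_assoc]

/-- Fusion of the Yang–Baxter equation along the second strand. -/
lemma yangBaxter_fuse_middle {a a' b c c' : G} (h : a * b * c = c * b * a)
    (h' : a' * b * c' = c' * b * a') (h₁ : Commute a' c) (h₂ : Commute a c') :
    (a' * a) * b * (c * c') = (c * c') * b * (a' * a) := by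
  calc (a' * a) * b * (c * c') = a' * (a * b * c) * c' := by simp only [mul_assoc]
    _ = (a' * c) * b * (a * c') := by rw [h]; simp only [mul_assoc]
    _ = c * (a' * b * c') * a := by rw [h₁.eq, h₂.eq]; simp only [mul_assoc]
    _ = (c * c') * b * (a' * a) := by rw [h']; simp only [mul_assoc]

/-- Fusion of the Yang–Baxter equation along the third strand. -/
lemma yangBaxter_fuse_last {a b b' c c' : G} (h : a * b * c = c * b * a)
    (h' : a * b' * c' = c' * b' * a) (h₁ : Commute b' c) (h₂ : Commute b c') :
    a * (b * b') * (c * c') = (c * c') * (b * b') * a := by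
  calc a * (b * b') * (c * c') = a * b * (b' * c) * c' := by simp only [mul_assoc]
    _ = (a * b * c) * b' * c' := by rw [h₁.eq]; simp only [mul_assoc]
    _ = c * b * (a * b' * c') := by rw [h]; simp only [mul_assoc]
    _ = c * (b * c') * b' * a := by rw [h']; simp only [mul_assoc]
    _ = (c * c') * (b * b') * a := by rw [h₂.eq]; simp only [mul_assoc]

end Fusion

section TwoColours

variable {ι G : Type*} [Group G]

/-- Replace `q i j` by `(q j i)⁻¹` when `i` has colour `true` and `j` has colour `false`. -/
def twist (c : ι → Bool) (q : ι → ι → G) (i j : ι) : G :=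
  if c i && !c j then (q j i)⁻¹ else q i j

lemma twist_commute (c : ι → Bool) {q : ι → ι → G}
    (hcomm : ∀ i j k l, [i, j, k, l].Nodup → Commute (q i j) (q k l))
    {i j k l : ι} (h : [i, j, k, l].Nodup) : Commute (twist c q i j) (twist c q k l) := by
  have h₁ : [j, i, k, l].Nodup := by grind
  have h₂ : [i, j, l, k].Nodup := by grind
  have h₃ : [j, i, l, k].Nodup := by grind
  unfold twist
  split_ifs
  · exact (hcomm _ _ _ _ h₃).inv_inv
  · exact (hcomm _ _ _ _ h₁).inv_left
  · exact (hcomm _ _ _ _ h₂).inv_right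
  · exact hcomm _ _ _ _ h

lemma twist_yangBaxter (c : ι → Bool) {q : ι → ι → G}
    (hyb : ∀ i j k, [i, j, k].Nodup → q i j * q i k * q j k = q j k * q i k * q i j)
    {i j k : ι} (h : [i, j, k].Nodup) :
    twist c q i j * twist c q i k * twist c q j k =
      twist c q j k * twist c q i k * twist c q i j := by
  have flip_last {x y z : G} (h : x * y * z = z * y * x) : y * x * z⁻¹ = z⁻¹ * x * y := by
    rw [mul_inv_eq_iff_eq_mul, mul_assoc, mul_assoc, eq_inv_mul_iff_mul_eq, ← mul_assoc,
      ← mul_assoc, h]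
  have flip_first {x y z : G} (h : x * y * z = z * y * x) : x⁻¹ * z * y = y * z * x⁻¹ :=
    (flip_last h.symm).symm
  have flip_two {x y z : G} (h : x * y * z = z * y * x) :
      y⁻¹ * z⁻¹ * x = x * z⁻¹ * y⁻¹ := by
    rw [← mul_inv_rev, mul_assoc x, ← mul_inv_rev, inv_mul_eq_iff_eq_mul, ← mul_assoc,
      eq_mul_inv_iff_mul_eq, ← mul_assoc, h]
  have h_ikj : [i, k, j].Nodup := by grind
  have h_jik : [j, i, k].Nodup := by grind
  have h_jki : [j, k, i].Nodup := by grind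
  have h_kij : [k, i, j].Nodup := by grind
  cases hi : c i <;> cases hj : c j <;> cases hk : c k <;> simp only [twist, hi, hj, hk,
    Bool.not_true, Bool.not_false, Bool.and_true, Bool.and_false, Bool.false_eq_true, if_true,
    if_false]
  · exact hyb _ _ _ h
  · exact hyb _ _ _ h
  · exact flip_last (hyb _ _ _ h_ikj)
  · exact hyb _ _ _ h
  · exact flip_two (hyb _ _ _ h_jki)
  · exact flip_first (hyb _ _ _ h_jik)
  · exact (flip_two (hyb _ _ _ h_kij).symm).symm
  · exact hyb _ _ _ h

lemma yangBaxter_fuse_pairs {r : Fin 6 → Fin 6 → G}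
    (hcomm : ∀ i j k l, [i, j, k, l].Nodup → Commute (r i j) (r k l))
    (hyb : ∀ i j k, [i, j, k].Nodup → r i j * r i k * r j k = r j k * r i k * r i j) :
    (r 0 3 * r 0 2 * r 1 3 * r 1 2) * (r 0 5 * r 0 4 * r 1 5 * r 1 4) *
        (r 2 5 * r 2 4 * r 3 5 * r 3 4) =
      (r 2 5 * r 2 4 * r 3 5 * r 3 4) * (r 0 5 * r 0 4 * r 1 5 * r 1 4) *
        (r 0 3 * r 0 2 * r 1 3 * r 1 2) := by
  have last (x y : Fin 6) (h : [x, y, 5, 4].Nodup) :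
      r x y * (r x 5 * r x 4) * (r y 5 * r y 4) =
        (r y 5 * r y 4) * (r x 5 * r x 4) * r x y :=
    yangBaxter_fuse_last (hyb _ _ _ (by clear * - h; grind)) (hyb _ _ _ (by clear * - h; grind))
      (hcomm _ _ _ _ (by clear * - h; grind)) (hcomm _ _ _ _ (by clear * - h; grind))
  have middle (x : Fin 6) (h : [x, 2, 3, 5, 4].Nodup) :
      (r x 3 * r x 2) * (r x 5 * r x 4) * ((r 2 5 * r 2 4) * (r 3 5 * r 3 4)) =
        ((r 2 5 * r 2 4) * (r 3 5 * r 3 4)) * (r x 5 * r x 4) * (r x 3 * r x 2) :=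
    yangBaxter_fuse_middle (last x 2 (by clear * - h; grind)) (last x 3 (by clear * - h; grind))
      ((hcomm _ _ _ _ (by clear * - h; grind)).mul_right (hcomm _ _ _ _ (by clear * - h; grind)))
      ((hcomm _ _ _ _ (by clear * - h; grind)).mul_right (hcomm _ _ _ _ (by clear * - h; grind)))
  have comm₁₀ : Commute (r 1 3 * r 1 2) (r 0 5 * r 0 4) :=
    ((hcomm _ _ _ _ (by decide)).mul_right (hcomm _ _ _ _ (by decide))).mul_left
      ((hcomm _ _ _ _ (by decide)).mul_right (hcomm _ _ _ _ (by decide)))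
  have comm₀₁ : Commute (r 0 3 * r 0 2) (r 1 5 * r 1 4) :=
    ((hcomm _ _ _ _ (by decide)).mul_right (hcomm _ _ _ _ (by decide))).mul_left
      ((hcomm _ _ _ _ (by decide)).mul_right (hcomm _ _ _ _ (by decide)))
  simpa only [mul_assoc] using yangBaxter_fuse_first (middle 0 (by decide))
    (middle 1 (by decide)) comm₁₀ comm₀₁

end TwoColours

section Legs

variable {K : Type*} [Field K] {A R : Type*} [Ring A] [Algebra K A] [Semiring R] [Algebra K R]
  {ι : Type*} [DecidableEq ι]

/-- The images of distinct members of the family commute elementwise. -/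
def PairwiseCommute (f : ι → A →ₐ[K] R) : Prop :=
  ∀ i j, i ≠ j → ∀ x y, Commute (f i x) (f j y)

/-- The unit `u` placed in the positions `i ≠ j` of a family of algebra maps with commuting
images. -/
def leg (f : ι → A →ₐ[K] R) (hf : PairwiseCommute f)
    (u : (A ⊗[K] A)ˣ) (i j : ι) : Rˣ :=
  if h : i ≠ j then
    Units.map (Algebra.TensorProduct.lift (f i) (f j) (hf i j h) : A ⊗[K] A →* R) u
  else 1

variable {f : ι → A →ₐ[K] R} {hf : PairwiseCommute f}

lemma val_leg (u : (A ⊗[K] A)ˣ) {i j : ι} (h : i ≠ j) :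
    (leg f hf u i j : R) = Algebra.TensorProduct.lift (f i) (f j) (hf i j h) u := by
  simp [leg, h]

lemma val_inv_leg (u : (A ⊗[K] A)ˣ) {i j : ι} (h : i ≠ j) :
    (((leg f hf u i j)⁻¹ : Rˣ) : R) =
      Algebra.TensorProduct.lift (f i) (f j) (hf i j h) (u⁻¹ : (A ⊗[K] A)ˣ) := by
  simp [leg, h, ← map_inv]

lemma leg_commute (u : (A ⊗[K] A)ˣ) {i j k l : ι} (h : [i, j, k, l].Nodup) :
    Commute (leg f hf u i j) (leg f hf u k l) := by
  have hij : i ≠ j := by grind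
  have hkl : k ≠ l := by grind
  have hik : i ≠ k := by grind
  have hil : i ≠ l := by grind
  have hjk : j ≠ k := by grind
  have hjl : j ≠ l := by grind
  have key (x y : A ⊗[K] A) : Commute (Algebra.TensorProduct.lift (f i) (f j) (hf i j hij) x)
      (Algebra.TensorProduct.lift (f k) (f l) (hf k l hkl) y) := by
    induction x with
    | zero => simp
    | add x x' hx hx' => rw [map_add]; exact hx.add_left hx'
    | tmul a b =>
      induction y with
      | zero => simp
      | add y y' hy hy' => rw [map_add]; exact hy.add_right hy'
      | tmul c d =>
        simp only [Algebra.TensorProduct.lift_tmul]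
        exact ((hf _ _ hik _ _).mul_right (hf _ _ hil _ _)).mul_left
          ((hf _ _ hjk _ _).mul_right (hf _ _ hjl _ _))
  rw [← Commute.units_val_iff, val_leg u hij, val_leg u hkl]
  exact key _ _

lemma leg_yangBaxter (u : (A ⊗[K] A)ˣ)
    (hu : emb12 K A A A u * emb13 K A A A u * emb23 K A A A u =
      emb23 K A A A u * emb13 K A A A u * emb12 K A A A (u : A ⊗[K] A))
    {i j k : ι} (h : [i, j, k].Nodup) :
    leg f hf u i j * leg f hf u i k * leg f hf u j k =
      leg f hf u j k * leg f hf u i k * leg f hf u i j := by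
  have hij : i ≠ j := by grind
  have hik : i ≠ k := by grind
  have hjk : j ≠ k := by grind
  have hcomm (x : A) (y : A ⊗[K] A) :
      Commute (f i x) (Algebra.TensorProduct.lift (f j) (f k) (hf j k hjk) y) := by
    induction y with
    | zero => simp
    | add y y' hy hy' => rw [map_add]; exact hy.add_right hy'
    | tmul c d =>
      rw [Algebra.TensorProduct.lift_tmul]
      exact (hf _ _ hij _ _).mul_right (hf _ _ hik _ _)
  let F : A ⊗[K] (A ⊗[K] A) →ₐ[K] R := Algebra.TensorProduct.lift (f i) _ hcomm
  have h₁₂ : F.comp (emb12 K A A A) = Algebra.TensorProduct.lift (f i) (f j) (hf i j hij) := by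
    ext x <;> simp [F, emb12]
  have h₁₃ : F.comp (emb13 K A A A) = Algebra.TensorProduct.lift (f i) (f k) (hf i k hik) := by
    ext x <;> simp [F, emb13]
  have h₂₃ : F.comp (emb23 K A A A) = Algebra.TensorProduct.lift (f j) (f k) (hf j k hjk) := by
    ext x <;> simp [F, emb23]
  apply Units.ext
  simp only [Units.val_mul, val_leg u hij, val_leg u hik, val_leg u hjk, ← h₁₂, ← h₁₃, ← h₂₃,
    AlgHom.comp_apply, ← map_mul, hu]

lemma leg_fuse_pairs (c : Fin 6 → Bool) {f : Fin 6 → A →ₐ[K] R}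
    (hf : PairwiseCommute f) (u : (A ⊗[K] A)ˣ)
    (hu : emb12 K A A A u * emb13 K A A A u * emb23 K A A A u =
      emb23 K A A A u * emb13 K A A A u * emb12 K A A A (u : A ⊗[K] A)) :
    letI r := twist c (leg f hf u)
    (r 0 3 * r 0 2 * r 1 3 * r 1 2) * (r 0 5 * r 0 4 * r 1 5 * r 1 4) *
        (r 2 5 * r 2 4 * r 3 5 * r 3 4) =
      (r 2 5 * r 2 4 * r 3 5 * r 3 4) * (r 0 5 * r 0 4 * r 1 5 * r 1 4) *
        (r 0 3 * r 0 2 * r 1 3 * r 1 2) :=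
  yangBaxter_fuse_pairs
    (fun _ _ _ _ ↦ twist_commute c (q := leg f hf u) fun _ _ _ _ ↦ leg_commute u)
    (fun _ _ _ ↦ twist_yangBaxter c (q := leg f hf u) fun _ _ _ ↦ leg_yangBaxter u hu)

end Legs

section TensorSquare

variable {K : Type*} [Field K] {A : Type*} [Ring A] [Algebra K A]

/-- The six coordinate embeddings of `A` into `(A ⊗ A) ⊗ ((A ⊗ A) ⊗ (A ⊗ A))`. -/
def slot : Fin 6 → A →ₐ[K] (A ⊗[K] A) ⊗[K] ((A ⊗[K] A) ⊗[K] (A ⊗[K] A)) :=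
  let l : A →ₐ[K] A ⊗[K] A := Algebra.TensorProduct.includeLeft
  let r : A →ₐ[K] A ⊗[K] A := Algebra.TensorProduct.includeRight
  let i₁ : A ⊗[K] A →ₐ[K] (A ⊗[K] A) ⊗[K] ((A ⊗[K] A) ⊗[K] (A ⊗[K] A)) :=
    Algebra.TensorProduct.includeLeft
  let i₂ := (emb23 K (A ⊗[K] A) (A ⊗[K] A) (A ⊗[K] A)).comp Algebra.TensorProduct.includeLeft
  let i₃ := (emb23 K (A ⊗[K] A) (A ⊗[K] A) (A ⊗[K] A)).comp Algebra.TensorProduct.includeRight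
  ![i₁.comp l, i₁.comp r, i₂.comp l, i₂.comp r, i₃.comp l, i₃.comp r]

lemma slot_commute : PairwiseCommute (slot (K := K) (A := A)) := by
  intro i j h x y
  fin_cases i <;> fin_cases j <;> first
    | exact absurd rfl h
    | simp [slot, emb23, commute_iff_eq]

lemma tensorSquare_qybe (u : (A ⊗[K] A)ˣ)
    (hu : emb12 K A A A u * emb13 K A A A u * emb23 K A A A u =
      emb23 K A A A u * emb13 K A A A u * emb12 K A A A (u : A ⊗[K] A))
    {α : (A ⊗[K] A) ⊗[K] (A ⊗[K] A)}
    (hα : α = E14 K A A A A u * E13 K A A A A u * E24 K A A A A u *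
      E32 K A A A A (u⁻¹ : (A ⊗[K] A)ˣ)) :
    emb12 K _ _ _ α * emb13 K _ _ _ α * emb23 K _ _ _ α =
      emb23 K _ _ _ α * emb13 K _ _ _ α * emb12 K _ _ _ α := by
  let c : Fin 6 → Bool := ![false, true, false, true, false, true]
  have key := congrArg Units.val (leg_fuse_pairs c slot_commute u hu)
  have lift_eq {i j : Fin 6} (h : i ≠ j)
      {F : A ⊗[K] A →ₐ[K] (A ⊗[K] A) ⊗[K] ((A ⊗[K] A) ⊗[K] (A ⊗[K] A))}
      (hl : ∀ x, F (x ⊗ₜ 1) = slot i x) (hr : ∀ x, F (1 ⊗ₜ x) = slot j x) :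
      Algebra.TensorProduct.lift (slot (K := K) (A := A) i) (slot j) (slot_commute i j h) = F := by
    ext x
    · simpa using (hl x).symm
    · simpa using (hr x).symm
  have embed (e : (A ⊗[K] A) ⊗[K] (A ⊗[K] A) →ₐ[K]
      (A ⊗[K] A) ⊗[K] ((A ⊗[K] A) ⊗[K] (A ⊗[K] A))) {i i' j j' : Fin 6}
      (hi : ∀ x, e ((x ⊗ₜ 1) ⊗ₜ 1) = slot i x) (hi' : ∀ x, e ((1 ⊗ₜ x) ⊗ₜ 1) = slot i' x)
      (hj : ∀ x, e (1 ⊗ₜ (x ⊗ₜ 1)) = slot j x) (hj' : ∀ x, e (1 ⊗ₜ (1 ⊗ₜ x)) = slot j' x)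
      (h : [i, i', j, j'].Nodup) (hc : c i = false) (hc' : c i' = true) (hd : c j = false)
      (hd' : c j' = true) :
      e α = ((twist c (leg slot slot_commute u) i j' * twist c (leg slot slot_commute u) i j *
        twist c (leg slot slot_commute u) i' j' * twist c (leg slot slot_commute u) i' j : Units _) :
          (A ⊗[K] A) ⊗[K] ((A ⊗[K] A) ⊗[K] (A ⊗[K] A))) := by
    have h₁₄ : i ≠ j' := by grind
    have h₁₃ : i ≠ j := by grind
    have h₂₄ : i' ≠ j' := by grind
    have h₃₂ : j ≠ i' := by grind
    simp only [twist, hc, hc', hd, hd', Bool.not_true, Bool.not_false, Bool.and_true,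
      Bool.and_false, Bool.false_eq_true, if_true, if_false, Units.val_mul, val_leg u h₁₄,
      val_leg u h₁₃, val_leg u h₂₄, val_inv_leg u h₃₂]
    rw [lift_eq h₁₄ (F := e.comp (E14 K A A A A)), lift_eq h₁₃ (F := e.comp (E13 K A A A A)),
      lift_eq h₂₄ (F := e.comp (E24 K A A A A)), lift_eq h₃₂ (F := e.comp (E32 K A A A A)), hα]
    · simp
    all_goals
      intro x
      simp [E14, E13, E24, E32, E23, hi, hi', hj, hj', ← Algebra.TensorProduct.one_def]
  rw [embed (emb12 K _ _ _) (i := 0) (i' := 1) (j := 2) (j' := 3),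
    embed (emb13 K _ _ _) (i := 0) (i' := 1) (j := 4) (j' := 5),
    embed (emb23 K _ _ _) (i := 2) (i' := 3) (j := 4) (j' := 5)]
  · simpa only [Units.val_mul] using key
  all_goals first
    | rfl
    | decide
    | (intro x; simp [emb12, emb13, emb23, slot, Algebra.TensorProduct.one_def])

end TensorSquare

section Opify

variable {K : Type*} [Field K] {A B A' B' : Type*} [Ring A] [Ring B] [Algebra K A] [Algebra K B]
  [Ring A'] [Ring B'] [Algebra K A'] [Algebra K B']

@[simp]
lemma opify_tmul (a : A) (b : B) : opify K A B (a ⊗ₜ b) = a ⊗ₜ MulOpposite.op b := rfl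

lemma opify_map (f : A →ₐ[K] A') (g : B →ₐ[K] B') (x : A ⊗[K] B) :
    opify K A' B' (Algebra.TensorProduct.map f g x) =
      Algebra.TensorProduct.map f (AlgHom.op g) (opify K A B x) := by
  induction x with
  | zero => simp
  | add x y hx hy => simp only [map_add, hx, hy]
  | tmul a b => simp

/-- `opify` is multiplicative on elements whose second components commute. -/
lemma opify_mul_of_commute_right {B'' : Type*} [Ring B''] [Algebra K B'']
    {g : B →ₐ[K] B''} {g' : B' →ₐ[K] B''} (h : ∀ b b', Commute (g b) (g' b'))
    {x y : A ⊗[K] B''} (hx : x ∈ (Algebra.TensorProduct.map (AlgHom.id K A) g).range)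
    (hy : y ∈ (Algebra.TensorProduct.map (AlgHom.id K A) g').range) :
    opify K A B'' (x * y) = opify K A B'' x * opify K A B'' y := by
  obtain ⟨x, rfl⟩ := hx
  obtain ⟨y, rfl⟩ := hy
  induction x with
  | zero => simp
  | add x x' hx hx' => simp_all [add_mul]
  | tmul a b =>
    induction y with
    | zero => simp
    | add y y' hy hy' => simp_all [mul_add]
    | tmul c d => simp [(h b d).eq, ← MulOpposite.op_mul]

/-- `opify` is antimultiplicative on elements whose first components commute. -/
lemma opify_mul_of_commute_left {A'' : Type*} [Ring A''] [Algebra K A'']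
    {f : A →ₐ[K] A''} {f' : A' →ₐ[K] A''} (h : ∀ a a', Commute (f a) (f' a'))
    {x y : A'' ⊗[K] B} (hx : x ∈ (Algebra.TensorProduct.map f (AlgHom.id K B)).range)
    (hy : y ∈ (Algebra.TensorProduct.map f' (AlgHom.id K B)).range) :
    opify K A'' B (x * y) = opify K A'' B y * opify K A'' B x := by
  obtain ⟨x, rfl⟩ := hx
  obtain ⟨y, rfl⟩ := hy
  induction x with
  | zero => simp
  | add x x' hx hx' => simp_all [add_mul, mul_add]
  | tmul a b =>
    induction y with
    | zero => simp
    | add y y' hy hy' => simp_all [add_mul, mul_add]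
    | tmul c d => simp [(h a c).eq]

lemma opify_comm_mul_opify_comm {x y : A ⊗[K] B} (h : opify K A B x * opify K A B y = 1) :
    opify K B A (Algebra.TensorProduct.comm K A B y) *
      opify K B A (Algebra.TensorProduct.comm K A B x) = 1 := by
  let Θ : A ⊗[K] Bᵐᵒᵖ →ₗ[K] B ⊗[K] Aᵐᵒᵖ :=
    TensorProduct.map (MulOpposite.opLinearEquiv K).symm.toLinearMap
      (MulOpposite.opLinearEquiv K).toLinearMap ∘ₗ (TensorProduct.comm K A Bᵐᵒᵖ).toLinearMap
  have key (x y : A ⊗[K] B) : Θ (opify K A B x * opify K A B y) =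
      opify K B A (Algebra.TensorProduct.comm K A B y) *
        opify K B A (Algebra.TensorProduct.comm K A B x) := by
    induction x with
    | zero => simp
    | add x x' hx hx' => simp_all [add_mul, mul_add]
    | tmul a b =>
      induction y with
      | zero => simp
      | add y y' hy hy' => simp_all [add_mul, mul_add]
      | tmul c d => simp [Θ]
  rw [← key, h]
  simp [Θ, Algebra.TensorProduct.one_def]

lemma map_mem_range_left {A'' B'' : Type*} [Ring A''] [Ring B''] [Algebra K A''] [Algebra K B'']
    (f : A →ₐ[K] A'') (g : B →ₐ[K] B'') (x : A ⊗[K] B) :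
    Algebra.TensorProduct.map f g x ∈
      (Algebra.TensorProduct.map f (AlgHom.id K B'')).range := by
  refine ⟨Algebra.TensorProduct.map (AlgHom.id K A) g x, ?_⟩
  induction x with
  | zero => simp
  | add x y hx hy => simp_all
  | tmul a b => simp

lemma map_mem_range_right {A'' B'' : Type*} [Ring A''] [Ring B''] [Algebra K A''] [Algebra K B'']
    (f : A →ₐ[K] A'') (g : B →ₐ[K] B'') (x : A ⊗[K] B) :
    Algebra.TensorProduct.map f g x ∈
      (Algebra.TensorProduct.map (AlgHom.id K A'') g).range := by
  refine ⟨Algebra.TensorProduct.map f (AlgHom.id K B) x, ?_⟩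
  induction x with
  | zero => simp
  | add x y hx hy => simp_all
  | tmul a b => simp

lemma includeLeft_commute_includeRight (a : A) (b : B) :
    Commute ((Algebra.TensorProduct.includeLeft : A →ₐ[K] A ⊗[K] B) a)
      ((Algebra.TensorProduct.includeRight : B →ₐ[K] A ⊗[K] B) b) := by
  simp [commute_iff_eq]

lemma opify_E14_mul_E13_mul_E24_mul_E32 (a b c d : A ⊗[K] A) :
    opify K _ _ (E14 K A A A A a * E13 K A A A A b * E24 K A A A A c * E32 K A A A A d) =
      opify K _ _ (E24 K A A A A c) * opify K _ _ (E32 K A A A A d) *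
        (opify K _ _ (E14 K A A A A a) * opify K _ _ (E13 K A A A A b)) := by
  simp only [E13, E14, E24, E32, E23, AlgHom.comp_apply]
  rw [mul_assoc (_ * _), opify_mul_of_commute_left includeLeft_commute_includeRight
      (mul_mem (map_mem_range_left _ _ _) (map_mem_range_left _ _ _))
      (mul_mem (map_mem_range_left _ _ _) (map_mem_range_left _ _ _)),
    opify_mul_of_commute_right (fun b b' ↦ (includeLeft_commute_includeRight b' b).symm)
      (map_mem_range_right _ _ _) (map_mem_range_right _ _ _),
    opify_mul_of_commute_right (fun b b' ↦ (includeLeft_commute_includeRight b' b).symm)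
      (map_mem_range_right _ _ _) (map_mem_range_right _ _ _)]

lemma opify_E32_mul_E24_mul_E13_mul_E14 (a b c d : A ⊗[K] A) :
    opify K _ _ (E32 K A A A A d * E24 K A A A A c * E13 K A A A A b * E14 K A A A A a) =
      opify K _ _ (E13 K A A A A b) * opify K _ _ (E14 K A A A A a) *
        (opify K _ _ (E32 K A A A A d) * opify K _ _ (E24 K A A A A c)) := by
  simp only [E13, E14, E24, E32, E23, AlgHom.comp_apply]
  rw [mul_assoc (_ * _), opify_mul_of_commute_left
      (fun a a' ↦ (includeLeft_commute_includeRight a' a).symm)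
      (mul_mem (map_mem_range_left _ _ _) (map_mem_range_left _ _ _))
      (mul_mem (map_mem_range_left _ _ _) (map_mem_range_left _ _ _)),
    opify_mul_of_commute_right includeLeft_commute_includeRight
      (map_mem_range_right _ _ _) (map_mem_range_right _ _ _),
    opify_mul_of_commute_right includeLeft_commute_includeRight
      (map_mem_range_right _ _ _) (map_mem_range_right _ _ _)]

/-- Inverse pairs in `A ⊗ Bᵐᵒᵖ` are preserved by tensor products of algebra maps. -/
lemma opify_map_mul_opify_map {x y : A ⊗[K] B} (h : opify K A B x * opify K A B y = 1)
    (f : A →ₐ[K] A') (g : B →ₐ[K] B') :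
    opify K A' B' (Algebra.TensorProduct.map f g x) *
      opify K A' B' (Algebra.TensorProduct.map f g y) = 1 := by
  rw [opify_map, opify_map, ← map_mul, h, map_one]

end Opify

section Twisting

variable {K : Type*} [Field K] {A : Type*} [Ring A] [Algebra K A]

lemma map_comp_apply {f g f' g' : A →ₐ[K] A} (x : A ⊗[K] A) :
    Algebra.TensorProduct.map f g (Algebra.TensorProduct.map f' g' x) =
      Algebra.TensorProduct.map (f.comp f') (g.comp g') x := by
  rw [Algebra.TensorProduct.map_comp, AlgHom.comp_apply]

lemma map_map_left_of_invariant {f : A →ₐ[K] A} (g : A →ₐ[K] A) {x : A ⊗[K] A}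
    (hx : Algebra.TensorProduct.map f f x = x) :
    Algebra.TensorProduct.map g f (Algebra.TensorProduct.map f (AlgHom.id K A) x) =
      Algebra.TensorProduct.map g (AlgHom.id K A) x := by
  conv_rhs => rw [← hx]
  simp only [map_comp_apply, AlgHom.comp_id, AlgHom.id_comp]

lemma map_map_right_of_invariant {f : A →ₐ[K] A} (g : A →ₐ[K] A) {x : A ⊗[K] A}
    (hx : Algebra.TensorProduct.map f f x = x) :
    Algebra.TensorProduct.map f g (Algebra.TensorProduct.map (AlgHom.id K A) f x) =
      Algebra.TensorProduct.map (AlgHom.id K A) g x := by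
  conv_rhs => rw [← hx]
  simp only [map_comp_apply, AlgHom.comp_id, AlgHom.id_comp]

lemma map_map_E13 (f g f' g' : A →ₐ[K] A) (x : A ⊗[K] A) :
    Algebra.TensorProduct.map (Algebra.TensorProduct.map f g) (Algebra.TensorProduct.map f' g')
      (E13 K A A A A x) = E13 K A A A A (Algebra.TensorProduct.map f f' x) := by
  induction x with
  | zero => simp
  | add x y hx hy => simp only [map_add, hx, hy]
  | tmul a b => simp [E13]

lemma map_map_E14 (f g f' g' : A →ₐ[K] A) (x : A ⊗[K] A) :
    Algebra.TensorProduct.map (Algebra.TensorProduct.map f g) (Algebra.TensorProduct.map f' g')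
      (E14 K A A A A x) = E14 K A A A A (Algebra.TensorProduct.map f g' x) := by
  induction x with
  | zero => simp
  | add x y hx hy => simp only [map_add, hx, hy]
  | tmul a b => simp [E14]

lemma map_map_E24 (f g f' g' : A →ₐ[K] A) (x : A ⊗[K] A) :
    Algebra.TensorProduct.map (Algebra.TensorProduct.map f g) (Algebra.TensorProduct.map f' g')
      (E24 K A A A A x) = E24 K A A A A (Algebra.TensorProduct.map g g' x) := by
  induction x with
  | zero => simp
  | add x y hx hy => simp only [map_add, hx, hy]
  | tmul a b => simp [E24]

lemma map_map_E32 (f g f' g' : A →ₐ[K] A) (x : A ⊗[K] A) :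
    Algebra.TensorProduct.map (Algebra.TensorProduct.map f g) (Algebra.TensorProduct.map f' g')
      (E32 K A A A A x) = E32 K A A A A (Algebra.TensorProduct.map f' g x) := by
  induction x with
  | zero => simp
  | add x y hx hy => simp only [map_add, hx, hy]
  | tmul a b => simp [E32, E23]

lemma opify_E_mul_opify_E {x y : A ⊗[K] A} (h : opify K A A x * opify K A A y = 1) :
    opify K _ _ (E13 K A A A A x) * opify K _ _ (E13 K A A A A y) = 1 ∧
      opify K _ _ (E14 K A A A A x) * opify K _ _ (E14 K A A A A y) = 1 ∧
      opify K _ _ (E24 K A A A A x) * opify K _ _ (E24 K A A A A y) = 1 ∧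
      opify K _ _ (E32 K A A A A y) * opify K _ _ (E32 K A A A A x) = 1 :=
  ⟨opify_map_mul_opify_map h _ _, opify_map_mul_opify_map h _ _, opify_map_mul_opify_map h _ _,
    opify_map_mul_opify_map (opify_comm_mul_opify_comm h) _ _⟩

end Twisting

end OQApaper

/-- Theorem 3.7: for an OQA `(H, p, D, U)`, the tensor square `H ⊗ H`
carries the OQA structure `α̃ = pᵢ pⱼ ⊗ p_k P^l ⊗ pʲ P_l ⊗ pⁱ p^k`. -/
theorem oqa_tensor_square (K : Type*) [Field K] (A : Type*) [Ring A] [Algebra K A]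
    (p pinv : A ⊗[K] A) (σ τ : A ≃ₐ[K] A)
    (hp : IsOQA K p pinv σ τ) :
    ∃ ainv,
      IsOQA K
        (E14 K A A A A p * E13 K A A A A p * E24 K A A A A p * E32 K A A A A pinv)
        ainv (Algebra.TensorProduct.congr σ σ) (Algebra.TensorProduct.congr τ τ) := by
  have hσ : Algebra.TensorProduct.map (σ : A →ₐ[K] A) (σ : A →ₐ[K] A) p = p := hp.map_sigma
  have hτ : Algebra.TensorProduct.map (τ : A →ₐ[K] A) (τ : A →ₐ[K] A) p = p := hp.map_tau
  have map_pinv (f : A →ₐ[K] A) (hf : Algebra.TensorProduct.map f f p = p) :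
      Algebra.TensorProduct.map f f pinv = pinv := by
    have h := congrArg (Algebra.TensorProduct.map f f) hp.inv_mul
    rw [map_mul, hf, map_one] at h
    exact left_inv_eq_right_inv h hp.mul_inv
  have hσ' := map_pinv _ hσ
  have hτ' := map_pinv _ hτ
  have mul_inv (e : A ⊗[K] A →ₐ[K] (A ⊗[K] A) ⊗[K] (A ⊗[K] A)) : e p * e pinv = 1 := by
    rw [← map_mul, hp.mul_inv, map_one]
  have inv_mul (e : A ⊗[K] A →ₐ[K] (A ⊗[K] A) ⊗[K] (A ⊗[K] A)) : e pinv * e p = 1 := by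
    rw [← map_mul, hp.inv_mul, map_one]
  have cancel {M : Type _} [Monoid M] {a a' b b' c c' d d' : M} (ha : a * a' = 1)
      (hb : b * b' = 1) (hc : c * c' = 1) (hd : d * d' = 1) :
      (a * b * c * d) * (d' * c' * b' * a') = 1 := by
    calc (a * b * c * d) * (d' * c' * b' * a') = a * (b * (c * (d * d') * c') * b') * a' := by
          simp only [mul_assoc]
      _ = 1 := by simp only [hd, mul_one, hc, hb, ha]
  have op_mul : opify K A A (Algebra.TensorProduct.map (σ : A →ₐ[K] A) (AlgHom.id K A) pinv) *
      opify K A A (Algebra.TensorProduct.map (AlgHom.id K A) (τ : A →ₐ[K] A) p) = 1 :=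
    hp.op_mul_inv
  have op_mul' : opify K A A (Algebra.TensorProduct.map (AlgHom.id K A) (τ : A →ₐ[K] A) p) *
      opify K A A (Algebra.TensorProduct.map (σ : A →ₐ[K] A) (AlgHom.id K A) pinv) = 1 :=
    hp.op_inv_mul
  obtain ⟨h₁₃, h₁₄, h₂₄, -⟩ := opify_E_mul_opify_E op_mul
  obtain ⟨h₁₃', h₁₄', h₂₄', -⟩ := opify_E_mul_opify_E op_mul'
  have exch := opify_map_mul_opify_map op_mul (τ : A →ₐ[K] A) (σ : A →ₐ[K] A)
  have exch' := opify_map_mul_opify_map op_mul' (τ : A →ₐ[K] A) (σ : A →ₐ[K] A)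
  rw [map_map_left_of_invariant _ hσ', map_map_right_of_invariant _ hτ] at exch exch'
  obtain ⟨-, -, -, h₃₂⟩ := opify_E_mul_opify_E exch
  obtain ⟨-, -, -, h₃₂'⟩ := opify_E_mul_opify_E exch'
  refine ⟨E32 K A A A A p * E24 K A A A A pinv * E13 K A A A A pinv * E14 K A A A A pinv,
    ?_, ?_, ?_, ?_, ?_, ?_, ?_, ?_⟩
  · intro a
    induction a with
    | zero => simp
    | add x y hx hy => simp only [map_add, hx, hy]
    | tmul a b => simp [hp.comm_auto]
  · exact cancel (mul_inv _) (mul_inv _) (mul_inv _) (inv_mul _)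
  · exact cancel (mul_inv _) (inv_mul _) (inv_mul _) (inv_mul _)
  · change opify K _ _ (Algebra.TensorProduct.map (Algebra.TensorProduct.map (σ : A →ₐ[K] A)
      (σ : A →ₐ[K] A)) (AlgHom.id K _) _) * opify K _ _ (Algebra.TensorProduct.map (AlgHom.id K _)
      (Algebra.TensorProduct.map (τ : A →ₐ[K] A) (τ : A →ₐ[K] A)) _) = 1
    simp only [← Algebra.TensorProduct.map_id, map_mul, map_map_E13, map_map_E14, map_map_E24,
      map_map_E32]
    rw [opify_E14_mul_E13_mul_E24_mul_E32, opify_E32_mul_E24_mul_E13_mul_E14]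
    simpa only [mul_assoc] using cancel h₁₃ h₁₄ h₃₂ h₂₄
  · change opify K _ _ (Algebra.TensorProduct.map (AlgHom.id K _)
      (Algebra.TensorProduct.map (τ : A →ₐ[K] A) (τ : A →ₐ[K] A)) _) * opify K _ _
      (Algebra.TensorProduct.map (Algebra.TensorProduct.map (σ : A →ₐ[K] A)
      (σ : A →ₐ[K] A)) (AlgHom.id K _) _) = 1
    simp only [← Algebra.TensorProduct.map_id, map_mul, map_map_E13, map_map_E14, map_map_E24,
      map_map_E32]
    rw [opify_E14_mul_E13_mul_E24_mul_E32, opify_E32_mul_E24_mul_E13_mul_E14]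
    simpa only [mul_assoc] using cancel h₂₄' h₃₂' h₁₄' h₁₃'
  · change Algebra.TensorProduct.map (Algebra.TensorProduct.map (σ : A →ₐ[K] A) (σ : A →ₐ[K] A))
      (Algebra.TensorProduct.map (σ : A →ₐ[K] A) (σ : A →ₐ[K] A)) _ = _
    simp only [map_mul, map_map_E13, map_map_E14, map_map_E24, map_map_E32, hσ, hσ']
  · change Algebra.TensorProduct.map (Algebra.TensorProduct.map (τ : A →ₐ[K] A) (τ : A →ₐ[K] A))
      (Algebra.TensorProduct.map (τ : A →ₐ[K] A) (τ : A →ₐ[K] A)) _ = _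
    simp only [map_mul, map_map_E13, map_map_E14, map_map_E24, map_map_E32, hτ, hτ']
  · exact tensorSquare_qybe ⟨p, pinv, hp.mul_inv, hp.inv_mul⟩ hp.qybe rfl
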